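/- arXiv:2409.11312 — 2 statements merged into one kernel-verified Lean document; each statement's English description precedes it below -/
import Mathlib

section
/- Let y be an integer with 1 ≤ y ≤ k_d − k_c − 2, and let a_l, a_r be nonnegative integers with a_l + a_r < k_d − k_c − y. Then the map sending each pair (c, α), where c = (c₂,…,c_{y+1}) ∈ F₂^y and α is an integer with −a_l ≤ α ≤ a_r, to the tuple (p̃_j · O(q₁ + Σ_{m=2}^{y+1} c_m q_m, −α))_{j=1,…,n−k_c} ∈ F₂^{n−k_c} is injective: distinct pairs (c,α) give distinct tuples. -/
open Polynomial

abbrev F2 := ZMod 2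

abbrev Vec (n : ℕ) := ZMod n → F2

/-- Standard dot product on `F₂`-vectors indexed by a finite type. -/
def dot {ι : Type} [Fintype ι] (u v : ι → F2) : F2 := ∑ i, u i * v i

/-- Right cyclic shift by `α` positions (indices mod `n`). -/
def shiftR {n : ℕ} (c : Vec n) (α : ℤ) : Vec n := fun i => c (i - (α : ZMod n))

/-- Vectorization of a polynomial: `c₀+c₁x+⋯ ↦ (c₀,c₁,…,c_{n-1})`. -/
def polyVec {n : ℕ} (f : Polynomial F2) : Vec n := fun i => f.coeff i.val

/-- A binary cyclic code: a subspace of `F₂ⁿ` closed under cyclic shift. -/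
def IsCyclicCode {n : ℕ} (C : Submodule F2 (Vec n)) : Prop :=
  ∀ c ∈ C, shiftR c 1 ∈ C

/-- Dual code with respect to the standard dot product. -/
def dualCode {ι : Type} [Fintype ι] (C : Submodule F2 (ι → F2)) :
    Submodule F2 (ι → F2) where
  carrier := {w | ∀ c ∈ C, dot c w = 0}
  add_mem' := by
    intro a b ha hb c hc
    have h1 := ha c hc
    have h2 := hb c hc
    simp only [dot, Set.mem_setOf_eq, Pi.add_apply, mul_add, Finset.sum_add_distrib] at *
    rw [h1, h2, add_zero]
  zero_mem' := by
    intro c hc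
    simp [dot]
  smul_mem' := by
    intro r a ha c hc
    have h := ha c hc
    simp only [dot, Set.mem_setOf_eq, Pi.smul_apply, smul_eq_mul] at *
    calc (∑ i, c i * (r * a i)) = r * ∑ i, c i * a i := by
          rw [Finset.mul_sum]
          exact Finset.sum_congr rfl fun i _ => by ring
      _ = 0 := by rw [h, mul_zero]

/-- `g` is the generator polynomial of the cyclic code `C`: monic, divides `xⁿ−1`,
and `C` consists exactly of the vectorizations of the multiples `f·g` with
`deg f < n − deg g`. -/
structure IsGenPoly {n : ℕ} [NeZero n] (C : Submodule F2 (Vec n)) (g : Polynomial F2) :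
    Prop where
  monic : g.Monic
  dvd : g ∣ (X ^ n - 1)
  mem_iff : ∀ v : Vec n, v ∈ C ↔
    ∃ f : Polynomial F2, f.degree < ((n - g.natDegree : ℕ) : WithBot ℕ) ∧ v = polyVec (f * g)

/-- The reduction of a polynomial modulo `xⁿ - 1`, read as a vector: exponents are taken
modulo `n`. -/
noncomputable def cyclicVec (n : ℕ) : F2[X] →ₗ[F2] Vec n :=
  Polynomial.lsum fun k => LinearMap.toSpanSingleton F2 (Vec n) (Pi.single (k : ZMod n) 1)

lemma cyclicVec_monomial (n k : ℕ) (a : F2) :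
    cyclicVec n (monomial k a) = a • Pi.single (k : ZMod n) 1 := by
  simp [cyclicVec, Polynomial.lsum_apply, Polynomial.sum_monomial_index]

lemma shiftR_add {n : ℕ} (u v : Vec n) (α : ℤ) :
    shiftR (u + v) α = shiftR u α + shiftR v α := rfl

lemma shiftR_sub {n : ℕ} (u v : Vec n) (α : ℤ) :
    shiftR (u - v) α = shiftR u α - shiftR v α := rfl

lemma shiftR_smul {n : ℕ} (a : F2) (v : Vec n) (α : ℤ) :
    shiftR (a • v) α = a • shiftR v α := rfl

lemma shiftR_shiftR {n : ℕ} (v : Vec n) (α β : ℤ) :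
    shiftR (shiftR v α) β = shiftR v (α + β) := by
  funext i
  simp only [shiftR]
  push_cast
  congr 1
  ring

lemma shiftR_zero {n : ℕ} (v : Vec n) : shiftR v 0 = v := by
  funext i
  simp [shiftR]

lemma shiftR_cyclicVec (n k : ℕ) (f : F2[X]) :
    shiftR (cyclicVec n f) k = cyclicVec n (X ^ k * f) := by
  induction f using Polynomial.induction_on' with
  | add f g hf hg => rw [map_add, shiftR_add, hf, hg, mul_add, map_add]
  | monomial m a =>
    rw [X_pow_mul_monomial, cyclicVec_monomial, cyclicVec_monomial, shiftR_smul]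
    congr 1
    funext i
    simp only [shiftR, Pi.single_apply, Nat.cast_add, Int.cast_natCast, sub_eq_iff_eq_add]

lemma cyclicVec_eq_polyVec {n : ℕ} [NeZero n] {f : F2[X]} (hf : f.degree < n) :
    cyclicVec n f = polyVec f := by
  funext i
  have hsum := f.as_sum_range_C_mul_X_pow' (n := n) (by
    rcases eq_or_ne f 0 with rfl | h0
    · simpa using NeZero.pos n
    · exact (natDegree_lt_iff_degree_lt h0).2 hf)
  conv_lhs => rw [hsum]
  simp only [C_mul_X_pow_eq_monomial, map_sum, cyclicVec_monomial, Finset.sum_apply,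
    Pi.smul_apply, Pi.single_apply, smul_eq_mul, mul_ite, mul_one, mul_zero, polyVec]
  rw [Finset.sum_eq_single i.val]
  · simp
  · intro k hk hki
    rw [if_neg]
    rintro rfl
    exact hki (ZMod.val_cast_of_lt (Finset.mem_range.1 hk)).symm
  · intro h
    exact absurd (Finset.mem_range.2 i.val_lt) h

lemma cyclicVec_mul_X_pow_sub_one (n : ℕ) (f : F2[X]) :
    cyclicVec n ((X ^ n - 1) * f) = 0 := by
  rw [sub_mul, one_mul, map_sub, ← shiftR_cyclicVec, sub_eq_zero]
  funext i
  simp [shiftR]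

lemma X_pow_sub_one_dvd_of_cyclicVec_eq_zero {n : ℕ} [NeZero n] {f : F2[X]}
    (hf : cyclicVec n f = 0) : (X ^ n - 1 : F2[X]) ∣ f := by
  have hm : (X ^ n - 1 : F2[X]).Monic := monic_X_pow_sub_C 1 (NeZero.ne n)
  rw [← modByMonic_eq_zero_iff_dvd hm]
  have hdeg : (f %ₘ (X ^ n - 1)).degree < n := by
    refine (degree_modByMonic_lt f hm).trans_eq ?_
    exact degree_X_pow_sub_C (NeZero.pos n) 1
  have hzero : (polyVec (f %ₘ (X ^ n - 1)) : Vec n) = 0 := by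
    rw [← cyclicVec_eq_polyVec hdeg, modByMonic_eq_sub_mul_div, map_sub, hf,
      cyclicVec_mul_X_pow_sub_one, sub_zero]
  ext k
  rw [coeff_zero]
  rcases lt_or_ge k n with hk | hk
  · simpa [polyVec, ZMod.val_cast_of_lt hk] using congrFun hzero (k : ZMod n)
  · exact coeff_eq_zero_of_degree_lt (hdeg.trans_le (by exact_mod_cast hk))

namespace IsGenPoly

variable {n : ℕ} [NeZero n] {C : Submodule F2 (Vec n)} {g : F2[X]}

lemma degree_mul_lt (hg : IsGenPoly C g) {f : F2[X]}
    (hf : f.degree < ((n - g.natDegree : ℕ) : WithBot ℕ)) : (f * g).degree < n := by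
  rcases eq_or_ne f 0 with rfl | h0
  · simp
  have hlt := (natDegree_lt_iff_degree_lt h0).2 hf
  have hfg := mul_ne_zero h0 hg.monic.ne_zero
  rw [← natDegree_lt_iff_degree_lt hfg, natDegree_mul h0 hg.monic.ne_zero]
  omega

lemma dvd_of_cyclicVec_mem (hg : IsGenPoly C g) {f : F2[X]} (hf : cyclicVec n f ∈ C) :
    g ∣ f := by
  obtain ⟨h, hdeg, hh⟩ := (hg.mem_iff _).1 hf
  rw [← cyclicVec_eq_polyVec (hg.degree_mul_lt hdeg), ← sub_eq_zero, ← map_sub] at hh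
  have hdvd := hg.dvd.trans (X_pow_sub_one_dvd_of_cyclicVec_eq_zero hh)
  simpa using dvd_add hdvd (dvd_mul_left g h)

lemma polyVec_mem (hg : IsGenPoly C g) (hn : g.natDegree < n) : polyVec g ∈ C :=
  (hg.mem_iff _).2 ⟨1, by rw [degree_one]; exact_mod_cast Nat.sub_pos_of_lt hn, by rw [one_mul]⟩

/-- A vector orthogonal to the first `n - deg g` shifts of the generator is orthogonal to the
whole code. -/
lemma dot_eq_zero (hg : IsGenPoly C g) (hn : g.natDegree < n) {v : Vec n}
    (hv : ∀ k < n - g.natDegree, dot (shiftR (polyVec g : Vec n) k) v = 0)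
    {w : Vec n} (hw : w ∈ C) : dot w v = 0 := by
  obtain ⟨f, hdeg, rfl⟩ := (hg.mem_iff _).1 hw
  have hg' : g.degree < n := by
    rwa [← natDegree_lt_iff_degree_lt hg.monic.ne_zero]
  rw [← cyclicVec_eq_polyVec (hg.degree_mul_lt hdeg)]
  have hsum := f.as_sum_range_C_mul_X_pow' (n := n - g.natDegree) (by
    rcases eq_or_ne f 0 with rfl | h0
    · simpa using hn
    · exact (natDegree_lt_iff_degree_lt h0).2 hdeg)
  have key : cyclicVec n (f * g) =
      ∑ k ∈ Finset.range (n - g.natDegree), f.coeff k • shiftR (polyVec g : Vec n) k := by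
    conv_lhs => rw [hsum]
    rw [Finset.sum_mul, map_sum]
    refine Finset.sum_congr rfl fun k _ => ?_
    rw [mul_assoc, ← smul_eq_C_mul, map_smul, ← shiftR_cyclicVec, cyclicVec_eq_polyVec hg']
  have hdot : ∀ u : Vec n, dot u v = u ⬝ᵥ v := fun _ => rfl
  rw [key, hdot, sum_dotProduct]
  refine Finset.sum_eq_zero fun k hk => ?_
  rw [smul_dotProduct, ← hdot, hv k (Finset.mem_range.1 hk), smul_zero]

end IsGenPoly

/-- The double dual of a code is contained in the code. -/
lemma mem_of_forall_dualCode {ι : Type} [Fintype ι] {C : Submodule F2 (ι → F2)} {v : ι → F2}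
    (hv : ∀ w ∈ dualCode C, dot w v = 0) : v ∈ C := by
  classical
  by_contra hvC
  obtain ⟨φ, hφv, hφC⟩ := Submodule.exists_le_ker_of_notMem hvC
  have hφ : ∀ u, φ u = dot u fun i => φ (Pi.single i 1) := by
    intro u
    conv_lhs => rw [pi_eq_sum_univ' u]
    simp [dot, map_sum]
  apply hφv
  rw [hφ]
  have h := hv (fun i => φ (Pi.single i 1)) fun c hc => by
    rw [← hφ]
    exact hφC hc
  simpa only [dot, mul_comm] using h

lemma IsCyclicCode.shiftR_mem {n : ℕ} [NeZero n] {C : Submodule F2 (Vec n)}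
    (hC : IsCyclicCode C) {v : Vec n} (hv : v ∈ C) (α : ℤ) : shiftR v α ∈ C := by
  have hnat : ∀ k : ℕ, shiftR v k ∈ C := by
    intro k
    induction k with
    | zero => simpa [shiftR_zero] using hv
    | succ k ih => simpa [shiftR_shiftR] using hC _ ih
  convert hnat (α : ZMod n).val using 1
  funext i
  rw [shiftR, shiftR, Int.cast_natCast, ZMod.natCast_zmod_val]

/-- The polynomial `1 + ∑ cₘ x^{m+1}`. -/
noncomputable def combPoly {y : ℕ} (c : Fin y → F2) : F2[X] :=
  1 + ∑ m, C (c m) * X ^ ((m : ℕ) + 1)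

lemma coeff_zero_combPoly {y : ℕ} (c : Fin y → F2) : (combPoly c).coeff 0 = 1 := by
  simp [combPoly]

lemma coeff_succ_combPoly {y : ℕ} (c : Fin y → F2) (m : Fin y) :
    (combPoly c).coeff ((m : ℕ) + 1) = c m := by
  simp [combPoly, coeff_one, coeff_X_pow, Fin.val_inj]

lemma natDegree_combPoly_le {y : ℕ} (c : Fin y → F2) : (combPoly c).natDegree ≤ y := by
  refine natDegree_add_le_of_degree_le (by simp) ?_
  refine natDegree_sum_le_of_forall_le _ _ fun m _ => ?_
  exact (natDegree_C_mul_X_pow_le _ _).trans m.isLt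

lemma polyVec_add_sum_shiftR {n y : ℕ} [NeZero n] {q : F2[X]} (hq : q.degree < n)
    (c : Fin y → F2) :
    polyVec q + ∑ m, c m • shiftR (polyVec q : Vec n) (((m : ℕ) : ℤ) + 1) =
      cyclicVec n (combPoly c * q) := by
  rw [combPoly, add_mul, one_mul, map_add, Finset.sum_mul, map_sum, cyclicVec_eq_polyVec hq]
  congr 1
  refine Finset.sum_congr rfl fun m _ => ?_
  rw [mul_assoc, ← smul_eq_C_mul, map_smul, ← shiftR_cyclicVec, cyclicVec_eq_polyVec hq]
  push_cast
  rfl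

/-- If `s` divides `f - x^a f'` with `deg s` exceeding `y + a`, the two combinations and the
exponent agree. -/
lemma combPoly_eq_of_dvd {y a : ℕ} {c c' : Fin y → F2} {s : F2[X]}
    (hs : s ∣ combPoly c - X ^ a * combPoly c') (hdeg : y + a < s.natDegree) :
    c = c' ∧ a = 0 := by
  have hzero : combPoly c - X ^ a * combPoly c' = 0 := by
    refine eq_zero_of_dvd_of_natDegree_lt hs (lt_of_le_of_lt ?_ hdeg)
    refine (natDegree_sub_le _ _).trans
      (max_le ((natDegree_combPoly_le c).trans (Nat.le_add_right y a)) ?_)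
    refine natDegree_mul_le.trans ?_
    rw [natDegree_X_pow, add_comm]
    exact Nat.add_le_add_right (natDegree_combPoly_le c') a
  rw [sub_eq_zero] at hzero
  have ha : a = 0 := by
    by_contra ha
    have h0 := congrArg (fun f => coeff f 0) hzero
    simp [coeff_zero_combPoly, mul_coeff_zero, coeff_X_pow, Ne.symm ha] at h0
  subst ha
  rw [pow_zero, one_mul] at hzero
  refine ⟨funext fun m => ?_, rfl⟩
  rw [← coeff_succ_combPoly c, hzero, coeff_succ_combPoly]

/-- For `1 ≤ y ≤ k_d−k_c−2` and `aₗ + aᵣ < k_d−k_c−y`, the map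
`(c, α) ↦ (p̃_j · O(q₁ + Σ_{m=2}^{y+1} c_m q_m, −α))_{j=1,…,n−k_c}` is injective
on `F₂^y × [−aₗ, aᵣ]`. -/
theorem stmt3 (n kc kd : ℕ) [NeZero n] (C D : Submodule F2 (Vec n))
    (hCcyc : IsCyclicCode C) (hDcyc : IsCyclicCode D)
    (hdimC : Module.finrank F2 C = kc) (hdimD : Module.finrank F2 D = kd)
    (hCperp : dualCode C < C) (hCD : C < D) (hkckd : kc < kd)
    (p q pR : Polynomial F2)
    (hp : IsGenPoly C p) (hq : IsGenPoly D q) (hpR : IsGenPoly (dualCode C) pR)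
    (hdegp : p.natDegree = n - kc) (hdegq : q.natDegree = n - kd)
    (hdegpR : pR.natDegree = kc)
    (y al ar : ℕ) (hy1 : 1 ≤ y) (hy2 : y ≤ kd - kc - 2)
    (hsum : al + ar < kd - kc - y) :
    ∀ (c c' : Fin y → F2) (α α' : ℤ),
      -(al : ℤ) ≤ α → α ≤ (ar : ℤ) → -(al : ℤ) ≤ α' → α' ≤ (ar : ℤ) →
      (∀ j : ℕ, 1 ≤ j → j ≤ n - kc →
        dot (shiftR (polyVec pR : Vec n) ((j : ℤ) - 1))
          (shiftR (polyVec q + ∑ m, c m • shiftR (polyVec q : Vec n) (((m : ℕ) : ℤ) + 1))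
            (-α)) =
        dot (shiftR (polyVec pR : Vec n) ((j : ℤ) - 1))
          (shiftR (polyVec q + ∑ m, c' m • shiftR (polyVec q : Vec n) (((m : ℕ) : ℤ) + 1))
            (-α'))) →
      c = c' ∧ α = α' := by
  subst hdimC hdimD
  have hkc : 0 < Module.finrank F2 C := by
    rw [Module.finrank_pos_iff, Submodule.nontrivial_iff_ne_bot]
    rintro rfl
    exact not_lt_bot hCperp
  have hkdn : Module.finrank F2 D ≤ n := by
    simpa [ZMod.card] using Submodule.finrank_le D
  have hqdeg : q.degree < n := by
    rw [← natDegree_lt_iff_degree_lt hq.monic.ne_zero]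
    omega
  have hpn : p.natDegree < n := by omega
  obtain ⟨s, rfl⟩ : q ∣ p := hq.dvd_of_cyclicVec_mem (by
    rw [cyclicVec_eq_polyVec ((natDegree_lt_iff_degree_lt hp.monic.ne_zero).1 hpn)]
    exact hCD.le (hp.polyVec_mem hpn))
  have hs0 : s ≠ 0 := right_ne_zero_of_mul hp.monic.ne_zero
  have hsdeg : s.natDegree = Module.finrank F2 D - Module.finrank F2 C := by
    rw [natDegree_mul hq.monic.ne_zero hs0] at hdegp
    omega
  have ordered : ∀ (c c' : Fin y → F2) (α α' : ℤ), -(al : ℤ) ≤ α' → α ≤ (ar : ℤ) → α' ≤ α →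
      (∀ j : ℕ, 1 ≤ j → j ≤ n - Module.finrank F2 C →
        dot (shiftR (polyVec pR : Vec n) ((j : ℤ) - 1))
          (shiftR (polyVec q + ∑ m, c m • shiftR (polyVec q : Vec n) (((m : ℕ) : ℤ) + 1))
            (-α)) =
        dot (shiftR (polyVec pR : Vec n) ((j : ℤ) - 1))
          (shiftR (polyVec q + ∑ m, c' m • shiftR (polyVec q : Vec n) (((m : ℕ) : ℤ) + 1))
            (-α'))) →
      c = c' ∧ α = α' := by
    intro c c' α α' hα' hα hle h
    simp only [polyVec_add_sum_shiftR hqdeg] at h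
    obtain ⟨a, ha⟩ := Int.eq_ofNat_of_zero_le (sub_nonneg.2 hle)
    have hmem : shiftR (cyclicVec n (combPoly c * q)) (-α) -
        shiftR (cyclicVec n (combPoly c' * q)) (-α') ∈ C := by
      refine mem_of_forall_dualCode fun w hw => hpR.dot_eq_zero (by omega) (fun k hk => ?_) hw
      have hk' := h (k + 1) (by omega) (by omega)
      push_cast at hk'
      rw [add_sub_cancel_right] at hk'
      exact (dotProduct_sub _ _ _).trans (sub_eq_zero.2 hk')
    have hmem' := hCcyc.shiftR_mem hmem α
    rw [shiftR_sub, shiftR_shiftR, shiftR_shiftR, neg_add_cancel, shiftR_zero,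
      neg_add_eq_sub, ha, shiftR_cyclicVec, ← map_sub] at hmem'
    have hdvd := hp.dvd_of_cyclicVec_mem hmem'
    rw [← mul_assoc, ← sub_mul, mul_comm _ q] at hdvd
    obtain ⟨hc, ha0⟩ := combPoly_eq_of_dvd
      ((mul_dvd_mul_iff_left hq.monic.ne_zero).1 hdvd) (by omega)
    exact ⟨hc, by omega⟩
  intro c c' α α' hα hα2 hα' hα'2 h
  rcases le_total α' α with hle | hle
  · exact ordered c c' α α' hα' hα2 hle h
  · obtain ⟨hc, hαα⟩ := ordered c' c α' α hα hα'2 hle fun j h1 h2 => (h j h1 h2).symm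
    exact ⟨hc.symm, hαα.symm⟩
end

section
/- The following spanning-set identities hold: D^⊥ = span{q̃_i : 1 ≤ i ≤ n−k_d}; C^⊥ = span({q̃_i : 1 ≤ i ≤ n−k_d} ∪ {p̃_j : 1 ≤ j ≤ k_d−k_c}); C = span({q̃_i : 1 ≤ i ≤ n−k_d} ∪ {p̃_j : 1 ≤ j ≤ k_d−k_c} ∪ {p_l : 1 ≤ l ≤ 2k_c−n}); and D = span({q̃_i : 1 ≤ i ≤ n−k_d} ∪ {p̃_j : 1 ≤ j ≤ k_d−k_c} ∪ {p_l : 1 ≤ l ≤ 2k_c−n} ∪ {q_m : 1 ≤ m ≤ k_d−k_c}). -/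
open Polynomial

/-- Vectorization as a linear map. -/
noncomputable def polyVecLin (n : ℕ) : Polynomial F2 →ₗ[F2] Vec n where
  toFun := polyVec
  map_add' f g := by ext i; simp [polyVec]
  map_smul' c f := by ext i; simp [polyVec]

theorem polyVec_injOn {n : ℕ} [NeZero n] {f g : Polynomial F2}
    (hf : f.degree < (n : WithBot ℕ)) (hg : g.degree < (n : WithBot ℕ))
    (h : (polyVec f : Vec n) = polyVec g) : f = g := by
  ext i
  rcases lt_or_ge i n with hi | hi
  · simpa [polyVec, ZMod.val_cast_of_lt hi] using congrFun h (i : ZMod n)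
  · have hi' : (n : WithBot ℕ) ≤ i := by exact_mod_cast hi
    rw [coeff_eq_zero_of_degree_lt (hf.trans_le hi'), coeff_eq_zero_of_degree_lt (hg.trans_le hi')]

/-- A shift that does not wrap around is multiplication by a power of `X`. -/
theorem shiftR_polyVec {n : ℕ} [NeZero n] (g : Polynomial F2) (j : ℕ)
    (h : j + g.natDegree < n) :
    shiftR (polyVec g : Vec n) (j : ℤ) = polyVec (X ^ j * g) := by
  ext i
  have hj : ((j : ℕ) : ZMod n).val = j := ZMod.val_cast_of_lt (by omega)
  simp only [shiftR, polyVec, coeff_X_pow_mul', Int.cast_natCast]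
  split_ifs with hij
  · rw [ZMod.val_sub (by rwa [hj]), hj]
  · apply coeff_eq_zero_of_natDegree_lt
    have hval := ZMod.val_add (i - j : ZMod n) (j : ZMod n)
    rw [sub_add_cancel, hj] at hval
    by_contra hcon
    rw [Nat.mod_eq_of_lt (by omega)] at hval
    omega

theorem span_shiftR_polyVec {n : ℕ} [NeZero n] (g : Polynomial F2) (m : ℕ)
    (h : m + g.natDegree ≤ n) :
    Submodule.span F2 (Set.range fun j : Fin m => shiftR (polyVec g : Vec n) ((j : ℕ) : ℤ)) =
      (degreeLT F2 m).map (polyVecLin n ∘ₗ LinearMap.mulRight F2 g) := by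
  classical
  rw [degreeLT_eq_span_X_pow, Submodule.map_span]
  congr 1
  ext v
  simp only [Set.mem_range, Finset.coe_image, Finset.coe_range, Set.mem_image, Set.mem_Iio,
    exists_exists_and_eq_and, LinearMap.comp_apply, LinearMap.mulRight_apply]
  constructor
  · rintro ⟨j, rfl⟩
    exact ⟨j, j.2, (shiftR_polyVec g j (by omega)).symm⟩
  · rintro ⟨j, hj, rfl⟩
    exact ⟨⟨j, hj⟩, shiftR_polyVec g j (by omega)⟩

theorem mem_span_shiftR_polyVec {n : ℕ} [NeZero n] {g : Polynomial F2} {m : ℕ}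
    (h : m + g.natDegree ≤ n) {v : Vec n} :
    v ∈ Submodule.span F2
        (Set.range fun j : Fin m => shiftR (polyVec g : Vec n) ((j : ℕ) : ℤ)) ↔
      ∃ f : Polynomial F2, f.degree < (m : WithBot ℕ) ∧ v = polyVec (f * g) := by
  rw [span_shiftR_polyVec g m h, Submodule.mem_map]
  simp only [mem_degreeLT]
  exact exists_congr fun f => and_congr_right fun _ => eq_comm

theorem IsGenPoly.natDegree_le {n : ℕ} [NeZero n] {A : Submodule F2 (Vec n)}
    {a : Polynomial F2} (ha : IsGenPoly A a) : a.natDegree ≤ n := by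
  have hne : (X ^ n - 1 : Polynomial F2) ≠ 0 := X_pow_sub_C_ne_zero (NeZero.pos n) 1
  have hdeg : (X ^ n - 1 : Polynomial F2).natDegree = n := natDegree_X_pow_sub_C (r := 1)
  exact hdeg ▸ natDegree_le_of_dvd ha.dvd hne

theorem IsGenPoly.eq_span {n : ℕ} [NeZero n] {A : Submodule F2 (Vec n)}
    {a : Polynomial F2} (ha : IsGenPoly A a) :
    A = Submodule.span F2 (Set.range fun j : Fin (n - a.natDegree) =>
      shiftR (polyVec a : Vec n) ((j : ℕ) : ℤ)) := by
  ext v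
  rw [ha.mem_iff, mem_span_shiftR_polyVec (Nat.sub_add_cancel ha.natDegree_le).le]

theorem degree_mul_lt_iff {f g : Polynomial F2} (hg : g.Monic) {m : ℕ} (h : g.natDegree ≤ m) :
    (f * g).degree < (m : WithBot ℕ) ↔ f.degree < ((m - g.natDegree : ℕ) : WithBot ℕ) := by
  rcases eq_or_ne f 0 with rfl | hf
  · simp
  · rw [← natDegree_lt_iff_degree_lt hf, ← natDegree_lt_iff_degree_lt (mul_ne_zero hf hg.ne_zero),
      natDegree_mul hf hg.ne_zero]
    omega

theorem IsGenPoly.natDegree_anti {n : ℕ} [NeZero n] {A B : Submodule F2 (Vec n)}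
    {a b : Polynomial F2} (ha : IsGenPoly A a) (hb : IsGenPoly B b) (hAB : A ≤ B) :
    b.natDegree ≤ a.natDegree := by
  rcases ha.natDegree_le.eq_or_lt with han | han
  · exact han ▸ hb.natDegree_le
  · have haA : (polyVec a : Vec n) ∈ A := by
      refine (ha.mem_iff _).2 ⟨1, ?_, by rw [one_mul]⟩
      rw [degree_one]
      exact_mod_cast Nat.sub_pos_of_lt han
    obtain ⟨t, ht, hat⟩ := (hb.mem_iff _).1 (hAB haA)
    rw [← degree_mul_lt_iff hb.monic hb.natDegree_le] at ht
    have hab : a = t * b :=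
      polyVec_injOn ((natDegree_lt_iff_degree_lt ha.monic.ne_zero).1 han) ht hat
    exact natDegree_le_of_dvd (Dvd.intro_left t hab.symm) ha.monic.ne_zero

/-- A cyclic code is spanned by any cyclic subcode together with the first few shifts of its
generator polynomial, as many as the difference of the degrees of the generator polynomials. -/
theorem IsGenPoly.eq_sup_span {n : ℕ} [NeZero n] {A B : Submodule F2 (Vec n)}
    {a b : Polynomial F2} (ha : IsGenPoly A a) (hb : IsGenPoly B b) (hAB : A ≤ B) {m : ℕ}
    (hm : b.natDegree + m = a.natDegree) :
    B = A ⊔ Submodule.span F2 (Set.range fun j : Fin m =>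
      shiftR (polyVec b : Vec n) ((j : ℕ) : ℤ)) := by
  have han := ha.natDegree_le
  apply le_antisymm
  · intro v hv
    obtain ⟨f, hf, rfl⟩ := (hb.mem_iff v).1 hv
    rw [← degree_mul_lt_iff hb.monic hb.natDegree_le] at hf
    set r := (f * b) %ₘ a
    set s := (f * b) /ₘ a
    have hrs : r + s * a = f * b := by rw [mul_comm s]; exact modByMonic_add_div (f * b) a
    have hr : r.degree < (a.natDegree : WithBot ℕ) :=
      (degree_modByMonic_lt _ ha.monic).trans_le degree_le_natDegree
    have hrn : r.degree < (n : WithBot ℕ) := hr.trans_le (by exact_mod_cast han)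
    have hs : (s * a).degree < (n : WithBot ℕ) := by
      rw [← sub_eq_of_eq_add' hrs.symm]
      exact (degree_sub_le _ _).trans_lt (max_lt hf hrn)
    have hsA : polyVecLin n (s * a) ∈ A :=
      (ha.mem_iff _).2 ⟨s, (degree_mul_lt_iff ha.monic han).1 hs, rfl⟩
    have hsum : polyVecLin n (f * b) = polyVecLin n (s * a) + polyVecLin n r := by
      rw [← map_add, add_comm, hrs]
    have hrB : polyVecLin n r ∈ B := by
      rw [← sub_eq_of_eq_add' hsum]
      exact B.sub_mem hv (hAB hsA)
    obtain ⟨t, ht, hrt⟩ := (hb.mem_iff _).1 hrB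
    rw [← degree_mul_lt_iff hb.monic hb.natDegree_le] at ht
    have hrt' : r = t * b := polyVec_injOn hrn ht hrt
    rw [hrt', degree_mul_lt_iff hb.monic (by omega)] at hr
    change polyVecLin n (f * b) ∈ _
    rw [hsum]
    refine Submodule.add_mem_sup hsA ((mem_span_shiftR_polyVec (by omega)).2 ⟨t, ?_, hrt⟩)
    rwa [← hm, Nat.add_sub_cancel_left] at hr
  · refine sup_le hAB fun v hv => ?_
    obtain ⟨f, hf, rfl⟩ := (mem_span_shiftR_polyVec (by omega)).1 hv
    exact (hb.mem_iff _).2 ⟨f, hf.trans_le (by exact_mod_cast (by omega)), rfl⟩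

theorem dualCode_anti {ι : Type} [Fintype ι] {C D : Submodule F2 (ι → F2)} (h : C ≤ D) :
    dualCode D ≤ dualCode C :=
  fun _ hw c hc => hw c (h hc)

/-- Spanning-set identities for `D^⊥ ⊆ C^⊥ ⊆ C ⊆ D` in terms of the
shifted generator-polynomial vectors `q̃_i, p̃_j, p_l, q_m`. -/
theorem stmt4 (n kc kd : ℕ) [NeZero n] (C D : Submodule F2 (Vec n))
    (hCcyc : IsCyclicCode C) (hDcyc : IsCyclicCode D)
    (hdimC : Module.finrank F2 C = kc) (hdimD : Module.finrank F2 D = kd)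
    (hCperp : dualCode C < C) (hCD : C < D) (hkckd : kc < kd)
    (p q pR qR : Polynomial F2)
    (hp : IsGenPoly C p) (hq : IsGenPoly D q)
    (hpR : IsGenPoly (dualCode C) pR) (hqR : IsGenPoly (dualCode D) qR)
    (hdegp : p.natDegree = n - kc) (hdegq : q.natDegree = n - kd)
    (hdegpR : pR.natDegree = kc) (hdegqR : qR.natDegree = kd) :
    dualCode D = Submodule.span F2
        (Set.range fun i : Fin (n - kd) => shiftR (polyVec qR : Vec n) ((i : ℕ) : ℤ)) ∧
    dualCode C = Submodule.span F2
        ((Set.range fun i : Fin (n - kd) => shiftR (polyVec qR : Vec n) ((i : ℕ) : ℤ)) ∪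
         (Set.range fun j : Fin (kd - kc) => shiftR (polyVec pR : Vec n) ((j : ℕ) : ℤ))) ∧
    C = Submodule.span F2
        ((Set.range fun i : Fin (n - kd) => shiftR (polyVec qR : Vec n) ((i : ℕ) : ℤ)) ∪
         (Set.range fun j : Fin (kd - kc) => shiftR (polyVec pR : Vec n) ((j : ℕ) : ℤ)) ∪
         (Set.range fun l : Fin (2 * kc - n) => shiftR (polyVec p : Vec n) ((l : ℕ) : ℤ))) ∧
    D = Submodule.span F2
        ((Set.range fun i : Fin (n - kd) => shiftR (polyVec qR : Vec n) ((i : ℕ) : ℤ)) ∪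
         (Set.range fun j : Fin (kd - kc) => shiftR (polyVec pR : Vec n) ((j : ℕ) : ℤ)) ∪
         (Set.range fun l : Fin (2 * kc - n) => shiftR (polyVec p : Vec n) ((l : ℕ) : ℤ)) ∪
         (Set.range fun m : Fin (kd - kc) => shiftR (polyVec q : Vec n) ((m : ℕ) : ℤ))) := by
  have hkd : kd ≤ n := hdegqR ▸ hqR.natDegree_le
  have hpp : n - kc ≤ kc := hdegp ▸ hdegpR ▸ hpR.natDegree_anti hp hCperp.le
  have hD' := hqR.eq_span
  rw [hdegqR] at hD'
  have hC' := hqR.eq_sup_span hpR (dualCode_anti hCD.le) (m := kd - kc) (by omega)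
  have hC := hpR.eq_sup_span hp hCperp.le (m := 2 * kc - n) (by omega)
  have hD := hp.eq_sup_span hq hCD.le (m := kd - kc) (by omega)
  simp only [Submodule.span_union]
  rw [← hD', ← hC', ← hC]
  exact ⟨rfl, rfl, rfl, hD⟩
end
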